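/- Fix i ≠ j in {1,…,n} and t ∈ [0,T]. Suppose φ_i(x,t,z) = x_i γ(x̄,t,z), where x̄ = (x_k)_{k≠i}, γ is measurable in z and C² in x̄ with derivatives bounded uniformly in z, and |γ(x̄,t,z)| ≤ √D. Assume that for every direction v ∈ ℝⁿ \ {0} and every x ∈ (0,∞)ⁿ, ∫₀¹ (∂_v² φ_i)(x,t,z) φ_i(x,t,z) dz ≥ 0, where ∂_v² denotes the second directional x-derivative in direction v. Then: (a) ∫₀¹ γ(x̄,t,z) ∂_{x_j}γ(x̄,t,z) dz = 0 for every x̄; and (b) for almost every z ∈ [0,1], γ(·,t,z) does not depend on x_j, i.e. φ_i is almost surely in z constant in x_j. -/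

import Mathlib

open MeasureTheory Set

noncomputable section

/-- The open positive orthant `(0,∞)ⁿ` in `ℝⁿ`. -/
def posOrth (n : ℕ) : Set (Fin n → ℝ) := {x | ∀ i, 0 < x i}

/-- Second directional derivative of `f` at `x` in direction `v`. -/
def dir2 {n : ℕ} (f : (Fin n → ℝ) → ℝ) (x v : Fin n → ℝ) : ℝ :=
  fderiv ℝ (fun y => fderiv ℝ f y v) x v

theorem isOpen_posOrth (n : ℕ) : IsOpen (posOrth n) := by
  have h : posOrth n = ⋂ i, {x : Fin n → ℝ | 0 < x i} := by
    ext x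
    simp [posOrth]
  rw [h]
  exact isOpen_iInter_of_finite fun i => isOpen_lt continuous_const (continuous_apply i)

theorem update_mem_posOrth {n : ℕ} {x : Fin n → ℝ} (hx : x ∈ posOrth n) (j : Fin n) {s : ℝ}
    (hs : 0 < s) : Function.update x j s ∈ posOrth n := by
  intro k
  rcases eq_or_ne k j with rfl | hk
  · simpa using hs
  · simpa [hk] using hx k

section FixedMark

variable {n : ℕ} {f : (Fin n → ℝ) → ℝ}

theorem fderiv_single_eq_zero_of_update_eq {i : Fin n}
    (hf : ∀ x c, f (Function.update x i c) = f x) (x : Fin n → ℝ) (a : ℝ) :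
    fderiv ℝ f x (Pi.single i a) = 0 := by
  by_cases hd : DifferentiableAt ℝ f x
  · have h1 : HasDerivAt (fun s => f (Function.update x i s))
        (fderiv ℝ f x (Pi.single i 1)) (x i) := by
      refine HasFDerivAt.comp_hasDerivAt (x i) ?_ (hasDerivAt_update x i (x i))
      simpa using hd.hasFDerivAt
    simp only [hf] at h1
    have h2 := h1.unique (hasDerivAt_const (x i) (f x))
    have h3 : (Pi.single i a : Fin n → ℝ) = a • Pi.single i 1 := by
      rw [← Pi.single_smul]
      simp
    rw [h3, map_smul, h2, smul_zero]
  · simp [fderiv_zero_of_not_differentiableAt hd]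

theorem fderiv_update_eq_of_update_eq {i : Fin n}
    (hf : ∀ x c, f (Function.update x i c) = f x) (x : Fin n → ℝ) (c : ℝ) :
    fderiv ℝ f (Function.update x i c) = fderiv ℝ f x := by
  have hx : Function.update x i c = x + Pi.single i (c - x i) := by
    ext k
    rcases eq_or_ne k i with rfl | hk
    · simp
    · simp [hk]
  have hshift : (fun y => f (y + Pi.single i (c - x i))) = f := by
    funext y
    have hy : y + Pi.single i (c - x i) = Function.update y i (y i + (c - x i)) := by
      ext k
      rcases eq_or_ne k i with rfl | hk
      · simp
      · simp [hk]
    rw [hy, hf]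
  rw [hx, ← fderiv_comp_add_right, hshift]

theorem contDiffOn_fderiv_apply (hf : ContDiffOn ℝ 2 f (posOrth n)) (w : Fin n → ℝ) :
    ContDiffOn ℝ 1 (fun y => fderiv ℝ f y w) (posOrth n) :=
  (hf.fderiv_of_isOpen (isOpen_posOrth n) (by norm_num)).clm_apply contDiffOn_const

theorem abs_dir2_single_le (hf : ContDiffOn ℝ 2 f (posOrth n)) {x : Fin n → ℝ}
    (hx : x ∈ posOrth n) (j : Fin n) :
    |dir2 f x (Pi.single j 1)| ≤ ‖fderiv ℝ (fderiv ℝ f) x‖ := by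
  have hd : DifferentiableAt ℝ (fderiv ℝ f) x :=
    ((hf.fderiv_of_isOpen (m := 1) (isOpen_posOrth n) (by norm_num)).differentiableOn
      (by norm_num)).differentiableAt ((isOpen_posOrth n).mem_nhds hx)
  have h : dir2 f x (Pi.single j 1)
      = fderiv ℝ (fderiv ℝ f) x (Pi.single j 1) (Pi.single j 1) := by
    rw [dir2, fderiv_clm_apply hd (differentiableAt_const _)]
    simp
  rw [h, ← Real.norm_eq_abs]
  refine (ContinuousLinearMap.le_opNorm₂ _ _ _).trans ?_
  simp [Pi.norm_single]

theorem hasDerivAt_update_of_contDiffOn {m : WithTop ℕ∞} (hf : ContDiffOn ℝ m f (posOrth n))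
    (hm : m ≠ 0) {x : Fin n → ℝ} (hx : x ∈ posOrth n) (j : Fin n) {s : ℝ} (hs : 0 < s) :
    HasDerivAt (fun r => f (Function.update x j r))
      (fderiv ℝ f (Function.update x j s) (Pi.single j 1)) s :=
  ((hf.differentiableOn hm).differentiableAt ((isOpen_posOrth n).mem_nhds
    (update_mem_posOrth hx j hs))).hasFDerivAt.comp_hasDerivAt s (hasDerivAt_update x j s)

theorem dir2_coord_mul {i j : Fin n} (hij : i ≠ j)
    (hindep : ∀ x c, f (Function.update x i c) = f x) (hf : ContDiffOn ℝ 2 f (posOrth n))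
    {x : Fin n → ℝ} (hx : x ∈ posOrth n) (a s : ℝ) :
    dir2 (fun y => y i * f y) x (Pi.single i a + Pi.single j s)
      = 2 * a * s * fderiv ℝ f x (Pi.single j 1)
        + x i * s ^ 2 * dir2 f x (Pi.single j 1) := by
  have hs : (Pi.single j s : Fin n → ℝ) = s • Pi.single j 1 := by
    rw [← Pi.single_smul]
    simp
  have hopen := isOpen_posOrth n
  have hcoord : ∀ y : Fin n → ℝ, HasFDerivAt (fun y : Fin n → ℝ => y i)
      (ContinuousLinearMap.proj i : (Fin n → ℝ) →L[ℝ] ℝ) y := fun y =>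
    hasFDerivAt_apply i y
  have hfd : ∀ y ∈ posOrth n, HasFDerivAt f (fderiv ℝ f y) y := fun y hy =>
    ((hf.differentiableOn (by norm_num)).differentiableAt (hopen.mem_nhds hy)).hasFDerivAt
  set G : (Fin n → ℝ) → ℝ := fun y => fderiv ℝ f y (Pi.single j 1) with hG
  have hGd : HasFDerivAt G (fderiv ℝ G x) x :=
    (((contDiffOn_fderiv_apply hf _).differentiableOn (by norm_num)).differentiableAt
      (hopen.mem_nhds hx)).hasFDerivAt
  have hGindep : ∀ y c, G (Function.update y i c) = G y := fun y c => by
    simp only [hG, fderiv_update_eq_of_update_eq hindep]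
  have hfirst : (fun y => fderiv ℝ (fun y => y i * f y) y (Pi.single i a + Pi.single j s))
      =ᶠ[nhds x] fun y => a * f y + s * (y i * G y) := by
    filter_upwards [hopen.mem_nhds hx] with y hy
    have hprod : fderiv ℝ (fun y => y i * f y) y = _ := ((hcoord y).mul (hfd y hy)).fderiv
    rw [hprod]
    simp only [add_apply, smul_apply, map_add,
      fderiv_single_eq_zero_of_update_eq hindep, hs, map_smul, smul_eq_mul,
      ContinuousLinearMap.proj_apply, Pi.single_eq_same, Pi.single_eq_of_ne hij, hG]
    ring
  have hsecond : fderiv ℝ (fun y => a * f y + s * (y i * G y)) x = _ :=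
    (((hfd x hx).const_mul a).add (((hcoord x).mul hGd).const_mul s)).fderiv
  rw [dir2, hfirst.fderiv_eq, hsecond]
  simp only [add_apply, smul_apply, map_add,
      fderiv_single_eq_zero_of_update_eq hindep, fderiv_single_eq_zero_of_update_eq hGindep,
      hs, map_smul, smul_eq_mul,
      ContinuousLinearMap.proj_apply, Pi.single_eq_same, Pi.single_eq_of_ne hij, dir2]
  simp only [hG]
  ring

end FixedMark

theorem aestronglyMeasurable_of_hasDerivAt {α : Type*} [MeasurableSpace α] {μ : Measure α}
    {F : ℝ → α → ℝ} {F' : α → ℝ} {s : ℝ} (hs : 0 < s)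
    (hF : ∀ r, 0 < r → AEStronglyMeasurable (F r) μ)
    (hF' : ∀ᵐ z ∂μ, HasDerivAt (fun r => F r z) (F' z) s) : AEStronglyMeasurable F' μ := by
  have hlim : Filter.Tendsto (fun k : ℕ => 1 / ((k : ℝ) + 1)) Filter.atTop (nhdsWithin 0 {0}ᶜ) := by
    rw [tendsto_nhdsWithin_iff]
    exact ⟨tendsto_one_div_add_atTop_nhds_zero_nat,
      Filter.Eventually.of_forall fun k => (Nat.one_div_pos_of_nat (α := ℝ)).ne'⟩
  refine aestronglyMeasurable_of_tendsto_ae Filter.atTop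
    (f := fun (k : ℕ) z => (1 / ((k : ℝ) + 1))⁻¹ • (F (s + 1 / ((k : ℝ) + 1)) z - F s z)) ?_ ?_
  · intro k
    have hk : AEStronglyMeasurable (F (s + 1 / ((k : ℝ) + 1))) μ :=
      hF _ (add_pos hs Nat.one_div_pos_of_nat)
    exact (hk.sub (hF s hs)).const_smul (1 / ((k : ℝ) + 1))⁻¹
  · filter_upwards [hF'] with z hz
    exact hz.tendsto_slope_zero.comp hlim

theorem eq_zero_of_forall_quadratic_nonneg {a b : ℝ} (h : ∀ s : ℝ, 0 ≤ s * a + s ^ 2 * b) :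
    a = 0 := by
  have hd := discrim_le_zero (a := b) (b := a) (c := 0) fun s => by
    have := h s
    nlinarith
  rw [discrim] at hd
  nlinarith [sq_nonneg a]

section Marks

variable {n : ℕ} {γ : (Fin n → ℝ) → ℝ → ℝ}

theorem aestronglyMeasurable_fderiv_single
    (hmeas : ∀ x ∈ posOrth n, Measurable (fun z => γ x z))
    (hsmooth : ∀ z ∈ Icc (0:ℝ) 1, ContDiffOn ℝ 2 (fun x => γ x z) (posOrth n))
    {x : Fin n → ℝ} (hx : x ∈ posOrth n) (j : Fin n) :
    AEStronglyMeasurable (fun z => fderiv ℝ (fun y => γ y z) x (Pi.single j 1))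
      (volume.restrict (Icc (0:ℝ) 1)) := by
  refine aestronglyMeasurable_of_hasDerivAt (F := fun r z => γ (Function.update x j r) z)
    (hx j) (fun r hr => (hmeas _ (update_mem_posOrth hx j hr)).aestronglyMeasurable) ?_
  filter_upwards [ae_restrict_mem measurableSet_Icc] with z hz
  simpa using hasDerivAt_update_of_contDiffOn (hsmooth z hz) (by norm_num) hx j (hx j)

theorem aestronglyMeasurable_dir2_single
    (hmeas : ∀ x ∈ posOrth n, Measurable (fun z => γ x z))
    (hsmooth : ∀ z ∈ Icc (0:ℝ) 1, ContDiffOn ℝ 2 (fun x => γ x z) (posOrth n))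
    {x : Fin n → ℝ} (hx : x ∈ posOrth n) (j : Fin n) :
    AEStronglyMeasurable (fun z => dir2 (fun y => γ y z) x (Pi.single j 1))
      (volume.restrict (Icc (0:ℝ) 1)) := by
  refine aestronglyMeasurable_of_hasDerivAt
    (F := fun r z => fderiv ℝ (fun y => γ y z) (Function.update x j r) (Pi.single j 1))
    (hx j) (fun r hr =>
      aestronglyMeasurable_fderiv_single hmeas hsmooth (update_mem_posOrth hx j hr) j) ?_
  filter_upwards [ae_restrict_mem measurableSet_Icc] with z hz
  simpa [dir2] using hasDerivAt_update_of_contDiffOn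
    (contDiffOn_fderiv_apply (hsmooth z hz) (Pi.single j 1)) (by norm_num) hx j (hx j)

theorem integrable_mul_of_abs_le {u v : ℝ → ℝ} {A B : ℝ}
    (hu : AEStronglyMeasurable u (volume.restrict (Icc (0:ℝ) 1)))
    (hv : AEStronglyMeasurable v (volume.restrict (Icc (0:ℝ) 1)))
    (hA : ∀ z ∈ Icc (0:ℝ) 1, |u z| ≤ A) (hB : ∀ z ∈ Icc (0:ℝ) 1, |v z| ≤ B) :
    Integrable (fun z => u z * v z) (volume.restrict (Icc (0:ℝ) 1)) := by
  refine Integrable.of_bound (hu.mul hv) (A * B) ?_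
  filter_upwards [ae_restrict_mem measurableSet_Icc] with z hz
  rw [Real.norm_eq_abs, abs_mul]
  exact mul_le_mul (hA z hz) (hB z hz) (abs_nonneg _) ((abs_nonneg _).trans (hA z hz))

end Marks

theorem abs_fderiv_single_le {n : ℕ} (f : (Fin n → ℝ) → ℝ) (x : Fin n → ℝ) (j : Fin n) :
    |fderiv ℝ f x (Pi.single j 1)| ≤ ‖fderiv ℝ f x‖ := by
  simpa [Pi.norm_single] using (fderiv ℝ f x).le_opNorm (Pi.single j 1)

/-- Final step in the classification of convexity preserving jump structures: fix
`i ≠ j` and `t`, and suppose `φ_i(x,t,z) = x_i γ(x̄,t,z)` where `γ` does not depend on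
`x_i`, is measurable in `z`, `C²` in `x̄` with derivatives bounded uniformly in `z`, and
`|γ| ≤ √D`. If `∫₀¹ ∂_v²φ_i(x,t,z) φ_i(x,t,z) dz ≥ 0` for every direction `v ≠ 0` and
every `x ∈ (0,∞)ⁿ`, then (a) `∫₀¹ γ ∂_{x_j}γ dz = 0` for every `x`, and (b) for almost
every `z`, `γ(·,t,z)` does not depend on `x_j`, i.e. `φ_i` is a.s. in `z` constant
in `x_j`. -/
theorem jump_indep_of_other_coordinates {n : ℕ} (i j : Fin n) (hij : i ≠ j)
    (γ : (Fin n → ℝ) → ℝ → ℝ) (D : ℝ) (hD : 0 ≤ D)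
    (hγindep : ∀ x : Fin n → ℝ, ∀ c : ℝ, ∀ z : ℝ, γ (Function.update x i c) z = γ x z)
    (hmeas : ∀ x ∈ posOrth n, Measurable (fun z => γ x z))
    (hsmooth : ∀ z ∈ Icc (0:ℝ) 1, ContDiffOn ℝ 2 (fun x => γ x z) (posOrth n))
    (hbd : ∃ C : ℝ, ∀ z ∈ Icc (0:ℝ) 1, ∀ x ∈ posOrth n,
      ‖fderiv ℝ (fun y => γ y z) x‖ ≤ C ∧
      ‖fderiv ℝ (fderiv ℝ (fun y => γ y z)) x‖ ≤ C)
    (hγbound : ∀ x ∈ posOrth n, ∀ z ∈ Icc (0:ℝ) 1, |γ x z| ≤ Real.sqrt D)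
    (hineq : ∀ v : Fin n → ℝ, v ≠ 0 → ∀ x ∈ posOrth n,
      0 ≤ ∫ z in Icc (0:ℝ) 1,
        dir2 (fun y => y i * γ y z) x v * (x i * γ x z)) :
    (∀ x ∈ posOrth n,
      ∫ z in Icc (0:ℝ) 1, γ x z * fderiv ℝ (fun y => γ y z) x (Pi.single j 1) = 0) ∧
    (∀ᵐ z ∂(volume.restrict (Icc (0:ℝ) 1)), ∀ x ∈ posOrth n, ∀ c : ℝ, 0 < c →
      γ (Function.update x j c) z = γ x z) := by
  obtain ⟨C, hC⟩ := hbd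
  have hG_le : ∀ x ∈ posOrth n, ∀ z ∈ Icc (0:ℝ) 1,
      |fderiv ℝ (fun y => γ y z) x (Pi.single j 1)| ≤ C := fun x hx z hz =>
    (abs_fderiv_single_le _ x j).trans (hC z hz x hx).1
  have hH_le : ∀ x ∈ posOrth n, ∀ z ∈ Icc (0:ℝ) 1,
      |dir2 (fun y => γ y z) x (Pi.single j 1)| ≤ C := fun x hx z hz =>
    (abs_dir2_single_le (hsmooth z hz) hx j).trans (hC z hz x hx).2
  have hGm := fun x (hx : x ∈ posOrth n) =>
    aestronglyMeasurable_fderiv_single hmeas hsmooth hx j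
  have hHm := fun x (hx : x ∈ posOrth n) =>
    aestronglyMeasurable_dir2_single hmeas hsmooth hx j
  have hγG := fun x (hx : x ∈ posOrth n) => integrable_mul_of_abs_le
    (hmeas x hx).aestronglyMeasurable (hGm x hx) (hγbound x hx) (hG_le x hx)
  have hγH := fun x (hx : x ∈ posOrth n) => integrable_mul_of_abs_le
    (hmeas x hx).aestronglyMeasurable (hHm x hx) (hγbound x hx) (hH_le x hx)
  have hGG := fun x (hx : x ∈ posOrth n) => integrable_mul_of_abs_le
    (hGm x hx) (hGm x hx) (hG_le x hx) (hG_le x hx)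
  have hquad : ∀ x ∈ posOrth n, ∀ a s : ℝ, (Pi.single i a + Pi.single j s : Fin n → ℝ) ≠ 0 →
      0 ≤ 2 * a * s * x i * (∫ z in Icc (0:ℝ) 1,
          γ x z * fderiv ℝ (fun y => γ y z) x (Pi.single j 1))
        + x i ^ 2 * s ^ 2 * ∫ z in Icc (0:ℝ) 1,
          γ x z * dir2 (fun y => γ y z) x (Pi.single j 1) := by
    intro x hx a s hv
    refine (hineq _ hv x hx).trans_eq ?_
    rw [← integral_const_mul, ← integral_const_mul,
      ← integral_add ((hγG x hx).const_mul _) ((hγH x hx).const_mul _)]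
    refine setIntegral_congr_fun measurableSet_Icc fun z hz => ?_
    simp only [dir2_coord_mul hij (fun x c => hγindep x c z) (hsmooth z hz) hx]
    ring
  have horth : ∀ x ∈ posOrth n,
      ∫ z in Icc (0:ℝ) 1, γ x z * fderiv ℝ (fun y => γ y z) x (Pi.single j 1) = 0 := by
    intro x hx
    have hvec : ∀ s : ℝ, (Pi.single i 1 + Pi.single j s : Fin n → ℝ) ≠ 0 := fun s h0 => by
      simpa [Pi.single_eq_of_ne hij] using congrFun h0 i
    have h := eq_zero_of_forall_quadratic_nonneg
      (a := 2 * x i * ∫ z in Icc (0:ℝ) 1, γ x z * fderiv ℝ (fun y => γ y z) x (Pi.single j 1))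
      (b := x i ^ 2 * ∫ z in Icc (0:ℝ) 1, γ x z * dir2 (fun y => γ y z) x (Pi.single j 1))
      fun s => (hquad x hx 1 s (hvec s)).trans_eq (by ring)
    exact (mul_eq_zero.1 h).resolve_left (mul_pos two_pos (hx i)).ne'
  have hconvex : ∀ x ∈ posOrth n,
      0 ≤ ∫ z in Icc (0:ℝ) 1, γ x z * dir2 (fun y => γ y z) x (Pi.single j 1) := by
    intro x hx
    have h := hquad x hx 0 1 (fun h0 => by
      simpa using congrFun h0 j)
    have hxi : 0 < x i ^ 2 := pow_pos (hx i) 2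
    simp only [mul_zero, zero_mul, zero_add, one_pow, mul_one] at h
    exact nonneg_of_mul_nonneg_right h hxi
  have hsum : ∀ x ∈ posOrth n, ∫ z in Icc (0:ℝ) 1,
      (fderiv ℝ (fun y => γ y z) x (Pi.single j 1) * fderiv ℝ (fun y => γ y z) x (Pi.single j 1)
        + γ x z * dir2 (fun y => γ y z) x (Pi.single j 1)) = 0 := by
    intro x hx
    have hderiv := (hasDerivAt_integral_of_dominated_loc_of_deriv_le
      (μ := volume.restrict (Icc (0:ℝ) 1)) (x₀ := x j) (s := Ioi 0)
      (bound := fun _ => C * C + Real.sqrt D * C)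
      (F := fun s z => γ (Function.update x j s) z
        * fderiv ℝ (fun y => γ y z) (Function.update x j s) (Pi.single j 1))
      (F' := fun s z => fderiv ℝ (fun y => γ y z) (Function.update x j s) (Pi.single j 1)
          * fderiv ℝ (fun y => γ y z) (Function.update x j s) (Pi.single j 1)
        + γ (Function.update x j s) z
          * dir2 (fun y => γ y z) (Function.update x j s) (Pi.single j 1))
      (Ioi_mem_nhds (hx j)) ?_ ?_ ?_ ?_ (integrable_const _) ?_).2
    · have hzero : (fun s => ∫ z in Icc (0:ℝ) 1, γ (Function.update x j s) z
          * fderiv ℝ (fun y => γ y z) (Function.update x j s) (Pi.single j 1))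
          =ᶠ[nhds (x j)] fun _ => 0 := by
        filter_upwards [Ioi_mem_nhds (hx j)] with s hs
        exact horth _ (update_mem_posOrth hx j hs)
      have h := hderiv.unique ((hasDerivAt_const (x j) (0:ℝ)).congr_of_eventuallyEq hzero)
      simpa using h
    · filter_upwards [Ioi_mem_nhds (hx j)] with s hs
      exact (hγG _ (update_mem_posOrth hx j hs)).aestronglyMeasurable
    · simpa using hγG x hx
    · simpa only [Function.update_eq_self] using
        ((hGG x hx).fun_add (hγH x hx)).aestronglyMeasurable
    · filter_upwards [ae_restrict_mem measurableSet_Icc] with z hz s hs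
      have hu := update_mem_posOrth hx j hs
      refine (norm_add_le _ _).trans (add_le_add ?_ ?_)
      · rw [norm_mul]
        exact mul_le_mul (hG_le _ hu z hz) (hG_le _ hu z hz) (norm_nonneg _)
          ((abs_nonneg _).trans (hG_le _ hu z hz))
      · rw [norm_mul]
        exact mul_le_mul (hγbound _ hu z hz) (hH_le _ hu z hz) (norm_nonneg _)
          (Real.sqrt_nonneg D)
    · filter_upwards [ae_restrict_mem measurableSet_Icc] with z hz s hs
      exact (hasDerivAt_update_of_contDiffOn (hsmooth z hz) (by norm_num) hx j hs).mul
        (hasDerivAt_update_of_contDiffOn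
          (contDiffOn_fderiv_apply (hsmooth z hz) (Pi.single j 1)) (by norm_num) hx j hs)
  have hpartial : ∀ x ∈ posOrth n, ∀ᵐ z ∂(volume.restrict (Icc (0:ℝ) 1)),
      fderiv ℝ (fun y => γ y z) x (Pi.single j 1) = 0 := by
    intro x hx
    have h := hsum x hx
    rw [integral_add (hGG x hx) (hγH x hx)] at h
    have hnonneg : 0 ≤ fun z => fderiv ℝ (fun y => γ y z) x (Pi.single j 1)
        * fderiv ℝ (fun y => γ y z) x (Pi.single j 1) := fun z => mul_self_nonneg _
    have hle := hconvex x hx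
    have hge := integral_nonneg (μ := volume.restrict (Icc (0:ℝ) 1)) hnonneg
    have hsq := (integral_eq_zero_iff_of_nonneg hnonneg (hGG x hx)).1 (by linarith)
    filter_upwards [hsq] with z hz
    exact mul_self_eq_zero.1 hz
  refine ⟨horth, ?_⟩
  obtain ⟨S, hS, hSc, hSd⟩ := TopologicalSpace.IsSeparable.exists_countable_dense_subset
    (TopologicalSpace.IsSeparable.of_separableSpace (posOrth n))
  have hall : ∀ᵐ z ∂(volume.restrict (Icc (0:ℝ) 1)), ∀ x ∈ S,
      fderiv ℝ (fun y => γ y z) x (Pi.single j 1) = 0 :=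
    (ae_ball_iff hSc).2 fun x hx => hpartial x (hS hx)
  filter_upwards [hall, ae_restrict_mem measurableSet_Icc] with z hz hz01
  have hzero : ∀ x ∈ posOrth n, fderiv ℝ (fun y => γ y z) x (Pi.single j 1) = 0 := by
    have hcont := (contDiffOn_fderiv_apply (hsmooth z hz01) (Pi.single j 1)).continuousOn
    exact Set.EqOn.of_subset_closure (t := posOrth n) (s := S) hz hcont continuousOn_const hS hSd
  intro x hx c hc
  have hconst := (convex_Ioi (0:ℝ)).is_const_of_fderivWithin_eq_zero (𝕜 := ℝ)
    (f := fun r => γ (Function.update x j r) z) (x := c) (y := x j) ?_ ?_ hc (hx j)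
  · simpa using hconst
  · intro s hs
    exact (hasDerivAt_update_of_contDiffOn (hsmooth z hz01) (by norm_num) hx j
      hs).differentiableAt.differentiableWithinAt
  · intro s hs
    have h := hasDerivAt_update_of_contDiffOn (hsmooth z hz01) (by norm_num) hx j hs
    rw [hzero _ (update_mem_posOrth hx j hs)] at h
    rw [fderivWithin_of_isOpen isOpen_Ioi hs]
    ext
    simp [h.deriv]

end
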